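/- Let N be a finite set with |N| ≥ 2, x ∈ N, and M := N∖{x}. Given r in K_ℓ(M), define the set function m′ on N by m′(S) := r(S∩M) if x ∈ S and m′(S) := 0 otherwise. Then m′ belongs to K_ℓ(N), and r generates an extreme ray of the cone K_ℓ(M) if and only if m′ generates an extreme ray of the cone K_ℓ(N). -/

import Mathlib

/-- A set function `m` on the finite set `N` is supermodular if
`m A + m B ≤ m (A ∪ B) + m (A ∩ B)` for all `A, B ⊆ N`. -/
def Supermodular {α : Type*} [DecidableEq α] (N : Finset α) (m : Finset α → ℝ) : Prop :=
  ∀ A ⊆ N, ∀ B ⊆ N, m A + m B ≤ m (A ∪ B) + m (A ∩ B)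

/-- `Kl N m`: `m` is an ℓ-standardized supermodular set function on `N`. -/
def Kl {α : Type*} [DecidableEq α] (N : Finset α) (m : Finset α → ℝ) : Prop :=
  Supermodular N m ∧ m ∅ = 0 ∧ ∀ i ∈ N, m {i} = 0

/-- `m` generates an extreme ray of the cone `{m | C m}` of set functions on `N`. -/
def ExtremeRay {α : Type*} (N : Finset α) (C : (Finset α → ℝ) → Prop)
    (m : Finset α → ℝ) : Prop :=
  C m ∧ (∃ S ⊆ N, m S ≠ 0) ∧
  ∀ m₁ m₂ : Finset α → ℝ, C m₁ → C m₂ → (∀ S ⊆ N, m S = m₁ S + m₂ S) →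
    ∃ a b : ℝ, 0 ≤ a ∧ 0 ≤ b ∧ (∀ S ⊆ N, m₁ S = a * m S) ∧ (∀ S ⊆ N, m₂ S = b * m S)

/-- Adding an element to a set does not decrease an ℓ-standardized supermodular function. -/
lemma Kl.le_insert {α : Type*} [DecidableEq α] {N : Finset α} {m : Finset α → ℝ}
    (h : Kl N m) {A : Finset α} {i : α} (hA : A ⊆ N) (hi : i ∈ N) :
    m A ≤ m (insert i A) := by
  by_cases hiA : i ∈ A
  · rw [Finset.insert_eq_self.2 hiA]
  · have key := h.1 A hA {i} (Finset.singleton_subset_iff.2 hi)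
    rw [Finset.inter_singleton_of_notMem hiA, h.2.1, h.2.2 i hi, Finset.union_comm,
      ← Finset.insert_eq] at key
    linarith

/-- An ℓ-standardized supermodular function is monotone. -/
lemma Kl.mono {α : Type*} [DecidableEq α] {N : Finset α} {m : Finset α → ℝ}
    (h : Kl N m) {A B : Finset α} (hAB : A ⊆ B) (hB : B ⊆ N) : m A ≤ m B := by
  have key : ∀ C : Finset α, C ⊆ N → m A ≤ m (C ∪ A) := by
    intro C
    induction C using Finset.induction_on with
    | empty => simp
    | insert i C _ ih =>
      intro hC
      obtain ⟨hi, hC⟩ := Finset.insert_subset_iff.1 hC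
      rw [Finset.insert_union]
      exact (ih hC).trans (h.le_insert (Finset.union_subset hC (hAB.trans hB)) hi)
  simpa [Finset.union_eq_left.2 hAB] using key B hB

/-- An ℓ-standardized supermodular function is nonnegative. -/
lemma Kl.nonneg {α : Type*} [DecidableEq α] {N : Finset α} {m : Finset α → ℝ}
    (h : Kl N m) {A : Finset α} (hA : A ⊆ N) : 0 ≤ m A :=
  h.2.1.symm.le.trans (h.mono (Finset.empty_subset A) hA)

/-- The extension by zero of an ℓ-standardized supermodular function is of the same kind. -/
lemma Kl.zero_extension {α : Type*} [DecidableEq α] {N : Finset α} {x : α}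
    {r : Finset α → ℝ} (hr : Kl (N \ {x}) r) :
    Kl N (fun S => if x ∈ S then r (S ∩ (N \ {x})) else 0) := by
  refine ⟨fun A _ B _ => ?_, by simp, fun i _ => ?_⟩
  · have hunion := Finset.union_inter_distrib_right A B (N \ {x})
    have hinter := Finset.inter_inter_distrib_right A B (N \ {x})
    have hmono : ∀ C, C ⊆ A ∪ B → r (C ∩ (N \ {x})) ≤ r ((A ∪ B) ∩ (N \ {x})) := fun C hC =>
      hr.mono (Finset.inter_subset_inter_right hC) Finset.inter_subset_right
    by_cases hxA : x ∈ A <;> by_cases hxB : x ∈ B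
    · simpa [hxA, hxB, hunion, hinter] using
        hr.1 _ (Finset.inter_subset_right (s₁ := A)) _ (Finset.inter_subset_right (s₁ := B))
    · simpa [hxA, hxB] using hmono A Finset.subset_union_left
    · simpa [hxA, hxB] using hmono B Finset.subset_union_right
    · simp [hxA, hxB]
  · by_cases hxi : x = i
    · subst hxi
      simp [hr.2.1]
    · simp [hxi]

/-- The link at `x` of an ℓ-standardized supermodular function vanishing on all pairs
containing `x` is ℓ-standardized supermodular. -/
lemma Kl.link {α : Type*} [DecidableEq α] {N : Finset α} {x : α} (hx : x ∈ N)
    {m : Finset α → ℝ} (hm : Kl N m) (hpair : ∀ i ∈ N \ {x}, m (insert x {i}) = 0) :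
    Kl (N \ {x}) (fun T => m (insert x T)) := by
  refine ⟨fun A hA B hB => ?_, by simpa using hm.2.2 x hx, hpair⟩
  have key := hm.1 (insert x A) (Finset.insert_subset hx (hA.trans Finset.sdiff_subset))
    (insert x B) (Finset.insert_subset hx (hB.trans Finset.sdiff_subset))
  rwa [← Finset.insert_union_distrib, ← Finset.insert_inter_distrib] at key

/-- For `x ∈ N`, `M = N ∖ {x}` and `r ∈ K_ℓ(M)`, the function
`m'(S) = r (S∩M)` if `x ∈ S` and `= 0` otherwise belongs to `K_ℓ(N)`, and `r` is
extreme in `K_ℓ(M)` iff `m'` is extreme in `K_ℓ(N)`. -/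
theorem zero_extension_with_singleton
    {α : Type*} [DecidableEq α] (N : Finset α) (hN : 2 ≤ N.card)
    (x : α) (hx : x ∈ N) (M : Finset α) (hM : M = N \ {x})
    (r : Finset α → ℝ) (hr : Kl M r) :
    Kl N (fun S => if x ∈ S then r (S ∩ M) else 0) ∧
    (ExtremeRay M (Kl M) r ↔
      ExtremeRay N (Kl N) (fun S => if x ∈ S then r (S ∩ M) else 0)) := by
  subst hM
  have hM_insert : ∀ T ⊆ N \ {x}, insert x T ∩ (N \ {x}) = T := by
    intro T hT
    rw [Finset.insert_inter_of_notMem (by simp), Finset.inter_eq_left.2 hT]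
  have hN_insert : ∀ T ⊆ N \ {x}, insert x T ⊆ N := fun T hT =>
    Finset.insert_subset hx (hT.trans Finset.sdiff_subset)
  have hinsert : ∀ S ⊆ N, x ∈ S → insert x (S ∩ (N \ {x})) = S := by
    intro S hS hxS
    ext y
    have := @hS y
    by_cases hy : y = x <;> simp_all
  refine ⟨hr.zero_extension, ?_, ?_⟩
  · rintro ⟨-, ⟨T, hT, hrT⟩, hext⟩
    refine ⟨hr.zero_extension, ⟨insert x T, hN_insert T hT, by simpa [hM_insert T hT]⟩, ?_⟩
    intro m₁ m₂ h₁ h₂ hsum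
    have hlink : ∀ T ⊆ N \ {x}, r T = m₁ (insert x T) + m₂ (insert x T) := by
      intro T hT
      simpa [hM_insert T hT] using hsum _ (hN_insert T hT)
    have hpair : ∀ i ∈ N \ {x}, m₁ (insert x {i}) = 0 ∧ m₂ (insert x {i}) = 0 := by
      intro i hi
      have hiM := Finset.singleton_subset_iff.2 hi
      have := hlink _ hiM
      rw [hr.2.2 i hi] at this
      have n₁ := h₁.nonneg (hN_insert _ hiM)
      have n₂ := h₂.nonneg (hN_insert _ hiM)
      constructor <;> linarith
    have hzero : ∀ S ⊆ N, x ∉ S → m₁ S = 0 ∧ m₂ S = 0 := by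
      intro S hS hxS
      have := hsum S hS
      simp only [if_neg hxS] at this
      have n₁ := h₁.nonneg hS
      have n₂ := h₂.nonneg hS
      constructor <;> linarith
    obtain ⟨a, b, ha, hb, hma, hmb⟩ := hext _ _ (h₁.link hx fun i hi => (hpair i hi).1)
      (h₂.link hx fun i hi => (hpair i hi).2) hlink
    refine ⟨a, b, ha, hb, fun S hS => ?_, fun S hS => ?_⟩
    · by_cases hxS : x ∈ S
      · simpa only [hinsert S hS hxS, if_pos hxS] using
          hma (S ∩ (N \ {x})) Finset.inter_subset_right
      · simpa [hxS] using (hzero S hS hxS).1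
    · by_cases hxS : x ∈ S
      · simpa only [hinsert S hS hxS, if_pos hxS] using
          hmb (S ∩ (N \ {x})) Finset.inter_subset_right
      · simpa [hxS] using (hzero S hS hxS).2
  · rintro ⟨-, ⟨S, hS, hrS⟩, hext⟩
    have hxS : x ∈ S := by
      by_contra hxS
      simp [hxS] at hrS
    refine ⟨hr, ⟨S ∩ (N \ {x}), Finset.inter_subset_right, by simpa only [if_pos hxS] using hrS⟩,
      fun r₁ r₂ h₁ h₂ hsum => ?_⟩
    obtain ⟨a, b, ha, hb, hma, hmb⟩ := hext _ _ h₁.zero_extension h₂.zero_extension (by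
      intro S _
      by_cases hxS : x ∈ S
      · simpa only [if_pos hxS] using hsum _ Finset.inter_subset_right
      · simp [hxS])
    refine ⟨a, b, ha, hb, fun T hT => ?_, fun T hT => ?_⟩
    · simpa [hM_insert T hT] using hma _ (hN_insert T hT)
    · simpa [hM_insert T hT] using hmb _ (hN_insert T hT)
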